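/- arXiv:2111.12468 — 2 statements merged into one kernel-verified Lean document; each statement's English description precedes it below -/
import Mathlib

section
/- Let g and g′ be horofunctions of (T, |·|) given by g(v) = max_{i∈I}(−v_i − α_i) + max_{j∈J}(v_j − α_j) and g′(v) = max_{i∈I}(−v_i − β_i) + max_{j∈J}(v_j − β_j), with the same disjoint nonempty index sets I, J ⊆ {1,…,n}, where α, β ≥ 0 satisfy min_{i∈I} α_i = 0 = min_{j∈J} α_j and min_{i∈I} β_i = 0 = min_{j∈J} β_j. Then g and g′ are in the same part and δ(g,g′) = ( max_{i∈I}(α_i − β_i) + max_{i∈I}(β_i − α_i) ) + ( max_{j∈J}(α_j − β_j) + max_{j∈J}(β_j − α_j) ). -/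
open Filter Topology

/-- The internal function `h_y(z) = d(z,y) - d(b,y)` of a point `y`, for the
distance `d` with basepoint `b`. -/
noncomputable def intFn {M : Type*} (d : M → M → ℝ) (b y : M) : M → ℝ :=
  fun z => d z y - d b y

/-- The horofunction compactification of `(M,d)` with basepoint `b`: the closure of the
set of internal functions in the space of all real functions on `M` with the topology of
pointwise convergence. -/
def horoCpt {M : Type*} (d : M → M → ℝ) (b : M) : Set (M → ℝ) :=
  closure (Set.range (intFn d b))

/-- The detour cost `H(h,h')`. -/
noncomputable def detourCost {M : Type*} (d : M → M → ℝ) (b : M) (h h' : M → ℝ) : EReal :=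
  ⨆ W ∈ 𝓝[horoCpt d b] h, ⨅ x ∈ {x : M | intFn d b x ∈ W}, ((d b x + h' x : ℝ) : EReal)

/-- The detour distance `δ(h,h') = H(h,h') + H(h',h)`. -/
noncomputable def detourDist {M : Type*} (d : M → M → ℝ) (b : M) (h h' : M → ℝ) : EReal :=
  detourCost d b h h' + detourCost d b h' h

/-- The space `T = {v ∈ ℝⁿ : v₁ + ⋯ + vₙ = 0}`. -/
def Tsp (n : ℕ) : Type := {v : Fin n → ℝ // ∑ i, v i = 0}

/-- The distance of the variation norm `|v| = max vᵢ - min vᵢ` on `T`. -/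
noncomputable def dVar (n : ℕ) (v w : Tsp n) : ℝ :=
  (⨆ i, (v.1 i - w.1 i)) - ⨅ i, (v.1 i - w.1 i)

/-- The basepoint `0 ∈ T`. -/
def zeroT (n : ℕ) : Tsp n := ⟨0, by simp⟩

/-- The representative in `T` of a vector `u` modulo constants. -/
noncomputable def centered {n : ℕ} (u : Fin n → ℝ) : Tsp n :=
  ⟨fun i => u i - (∑ k, u k) / n, by
    rcases Nat.eq_zero_or_pos n with rfl | hn
    · simp
    · have : (n : ℝ) ≠ 0 := by positivity
      simp only [Finset.sum_sub_distrib, Finset.sum_const, Finset.card_univ, Fintype.card_fin,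
        nsmul_eq_mul]
      field_simp
      ring⟩

/-- The function `v ↦ max_{i ∈ I} (-v_i - α_i) + max_{j ∈ J} (v_j - α_j)` on `T`. -/
noncomputable def maxFn {n : ℕ} {I J : Finset (Fin n)} (hI : I.Nonempty) (hJ : J.Nonempty)
    (α : Fin n → ℝ) (v : Tsp n) : ℝ :=
  I.sup' hI (fun i => -v.1 i - α i) + J.sup' hJ (fun j => v.1 j - α j)

section

variable {n : ℕ} {I J : Finset (Fin n)}

lemma sub_sub_sub_le_dVar (v w : Tsp n) (a b : Fin n) :
    (v.1 a - w.1 a) - (v.1 b - w.1 b) ≤ dVar n v w :=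
  sub_le_sub (le_ciSup (f := fun i => v.1 i - w.1 i) (Set.finite_range _).bddAbove a)
    (ciInf_le (f := fun i => v.1 i - w.1 i) (Set.finite_range _).bddBelow b)

lemma dVar_eq_of_forall_le {v w : Tsp n} {a b : Fin n}
    (ha : ∀ k, v.1 k - w.1 k ≤ v.1 a - w.1 a) (hb : ∀ k, v.1 b - w.1 b ≤ v.1 k - w.1 k) :
    dVar n v w = (v.1 a - w.1 a) - (v.1 b - w.1 b) := by
  have : Nonempty (Fin n) := ⟨a⟩
  exact le_antisymm (sub_le_sub (ciSup_le ha) (le_ciInf hb)) (sub_sub_sub_le_dVar v w a b)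

lemma sup'_const_add {ι : Type*} {s : Finset ι} (hs : s.Nonempty) (f : ι → ℝ) (c : ℝ) :
    s.sup' hs (fun i => c + f i) = c + s.sup' hs f :=
  (Finset.apply_sup'_eq_sup'_comp hs (fun x => c + x) fun x y => (max_add_add_left c x y).symm).symm

lemma sup'_neg_eq_zero {ι : Type*} {s : Finset ι} (hs : s.Nonempty) {f : ι → ℝ}
    (hf : s.inf' hs f = 0) : s.sup' hs (fun i => -f i) = 0 := by
  obtain ⟨i, hi, hfi⟩ := s.exists_mem_eq_inf' hs f
  refine le_antisymm (Finset.sup'_le _ _ fun k hk => ?_) (Finset.le_sup'_of_le _ hi (by linarith))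
  linarith [Finset.inf'_le f hk]

lemma maxFn_centered (hI : I.Nonempty) (hJ : J.Nonempty) (α u : Fin n → ℝ) :
    maxFn hI hJ α (centered u) =
      I.sup' hI (fun i => -u i - α i) + J.sup' hJ (fun j => u j - α j) := by
  have h1 := sup'_const_add hI (fun i => -u i - α i) ((∑ k, u k) / n)
  have h2 := sup'_const_add hJ (fun j => u j - α j) (-((∑ k, u k) / n))
  have e1 : (fun i => -(centered u).1 i - α i) = fun i => (∑ k, u k) / n + (-u i - α i) := by
    funext i; simp only [centered]; ring
  have e2 : (fun j => (centered u).1 j - α j) = fun j => -((∑ k, u k) / n) + (u j - α j) := by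
    funext i; simp only [centered]; ring
  rw [maxFn, e1, e2, h1, h2]
  ring

lemma maxFn_le_add_dVar (hI : I.Nonempty) (hJ : J.Nonempty) (α : Fin n → ℝ) (v w : Tsp n) :
    maxFn hI hJ α v ≤ maxFn hI hJ α w + dVar n v w := by
  obtain ⟨i, hi, hvi⟩ := I.exists_mem_eq_sup' hI (fun i => -v.1 i - α i)
  obtain ⟨j, hj, hvj⟩ := J.exists_mem_eq_sup' hJ (fun j => v.1 j - α j)
  have hwi := Finset.le_sup' (fun i => -w.1 i - α i) hi
  have hwj := Finset.le_sup' (fun j => w.1 j - α j) hj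
  rw [maxFn, maxFn, hvi, hvj]
  linarith [sub_sub_sub_le_dVar v w j i]

/-- The vector equal to `t - α` on `I`, to `α - t` on `J`, and to `0` elsewhere. -/
noncomputable def rayVec (I J : Finset (Fin n)) (α : Fin n → ℝ) (t : ℝ) (k : Fin n) : ℝ :=
  if k ∈ I then t - α k else if k ∈ J then α k - t else 0

lemma rayVec_of_mem_left (α : Fin n → ℝ) (t : ℝ) {k : Fin n} (hk : k ∈ I) :
    rayVec I J α t k = t - α k := if_pos hk

lemma rayVec_of_mem_right (hd : Disjoint I J) (α : Fin n → ℝ) (t : ℝ) {k : Fin n} (hk : k ∈ J) :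
    rayVec I J α t k = α k - t := by
  rw [rayVec, if_neg (Finset.disjoint_right.mp hd hk), if_pos hk]

/-- Along the ray, the distance to any point `z` is eventually `maxFn z + 2 t`. -/
lemma eventually_dVar_ray (hd : Disjoint I J) (hI : I.Nonempty) (hJ : J.Nonempty)
    (α : Fin n → ℝ) (z : Tsp n) :
    ∀ᶠ t : ℝ in atTop,
      dVar n z (centered (rayVec I J α t)) = maxFn hI hJ α z + 2 * t := by
  obtain ⟨B, hB⟩ := (Set.finite_range fun k => |z.1 k| + |α k|).bddAbove
  have hB' (k) : |z.1 k| + |α k| ≤ B := hB ⟨k, rfl⟩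
  obtain ⟨i, hi, hzi⟩ := I.exists_mem_eq_sup' hI (fun i => -z.1 i - α i)
  obtain ⟨j, hj, hzj⟩ := J.exists_mem_eq_sup' hJ (fun j => z.1 j - α j)
  filter_upwards [eventually_ge_atTop (2 * B)] with t ht
  have bound (k) : -B ≤ z.1 k + α k ∧ z.1 k + α k ≤ B ∧ -B ≤ z.1 k - α k ∧ z.1 k - α k ≤ B ∧
      -B ≤ z.1 k ∧ z.1 k ≤ B := by
    have := hB' k
    have := abs_le.mp (le_refl |z.1 k|)
    have := abs_le.mp (le_refl |α k|)
    have := abs_nonneg (α k)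
    refine ⟨?_, ?_, ?_, ?_, ?_, ?_⟩ <;> linarith
  have hri := rayVec_of_mem_left (J := J) α t hi
  have hrj := rayVec_of_mem_right hd α t hj
  have bi := bound i
  have bj := bound j
  rw [dVar_eq_of_forall_le (a := j) (b := i), maxFn, hzi, hzj]
  · simp only [centered, hri, hrj]
    ring
  · intro k
    have bk := bound k
    simp only [centered, hrj]
    by_cases hkJ : k ∈ J
    · have := Finset.le_sup' (fun j => z.1 j - α j) hkJ
      rw [rayVec_of_mem_right hd α t hkJ]
      linarith
    by_cases hkI : k ∈ I
    · rw [rayVec_of_mem_left α t hkI]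
      linarith
    · rw [rayVec, if_neg hkI, if_neg hkJ]
      linarith
  · intro k
    have bk := bound k
    simp only [centered, hri]
    by_cases hkI : k ∈ I
    · have := Finset.le_sup' (fun i => -z.1 i - α i) hkI
      rw [rayVec_of_mem_left α t hkI]
      linarith
    by_cases hkJ : k ∈ J
    · rw [rayVec_of_mem_right hd α t hkJ]
      linarith
    · rw [rayVec, if_neg hkI, if_neg hkJ]
      linarith

lemma maxFn_ray (hd : Disjoint I J) (hI : I.Nonempty) (hJ : J.Nonempty) (α β : Fin n → ℝ)
    (t : ℝ) :
    maxFn hI hJ β (centered (rayVec I J α t)) =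
      (I.sup' hI fun i => α i - β i) + (J.sup' hJ fun j => α j - β j) - 2 * t := by
  have e1 : I.sup' hI (fun i => -rayVec I J α t i - β i) =
      I.sup' hI (fun i => -t + (α i - β i)) :=
    Finset.sup'_congr hI rfl fun i hi => by rw [rayVec_of_mem_left α t hi]; ring
  have e2 : J.sup' hJ (fun j => rayVec I J α t j - β j) =
      J.sup' hJ (fun j => -t + (α j - β j)) :=
    Finset.sup'_congr hJ rfl fun j hj => by rw [rayVec_of_mem_right hd α t hj]; ring
  rw [maxFn_centered, e1, e2, sup'_const_add, sup'_const_add]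
  ring

lemma maxFn_zeroT (hI : I.Nonempty) (hJ : J.Nonempty) {α : Fin n → ℝ}
    (hαI : I.inf' hI α = 0) (hαJ : J.inf' hJ α = 0) : maxFn hI hJ α (zeroT n) = 0 := by
  simp [maxFn, zeroT, sup'_neg_eq_zero hI hαI, sup'_neg_eq_zero hJ hαJ]

lemma tendsto_intFn_ray (hd : Disjoint I J) (hI : I.Nonempty) (hJ : J.Nonempty)
    {α : Fin n → ℝ} (hαI : I.inf' hI α = 0) (hαJ : J.inf' hJ α = 0) :
    Tendsto (fun t => intFn (dVar n) (zeroT n) (centered (rayVec I J α t))) atTop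
      (𝓝[horoCpt (dVar n) (zeroT n)] (maxFn hI hJ α)) := by
  refine tendsto_nhdsWithin_iff.mpr
    ⟨tendsto_pi_nhds.mpr fun z => tendsto_const_nhds.congr' ?_,
      Eventually.of_forall fun t => subset_closure ⟨_, rfl⟩⟩
  filter_upwards [eventually_dVar_ray hd hI hJ α z, eventually_dVar_ray hd hI hJ α (zeroT n)]
    with t hz h0
  rw [intFn, hz, h0, maxFn_zeroT hI hJ hαI hαJ]
  ring

/-- A function `h'` that is 1-Lipschitz satisfies `h' z - h z ≤ H(h, h')` at every point `z`. -/
lemma sub_le_detourCost {M : Type*} (d : M → M → ℝ) (b : M) (h h' : M → ℝ)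
    (hlip : ∀ x y, h' x ≤ h' y + d x y) (z : M) :
    ((h' z - h z : ℝ) : EReal) ≤ detourCost d b h h' := by
  refine EReal.ge_of_forall_gt_iff_ge.mp fun c hc => ?_
  have hc' : c < h' z - h z := EReal.coe_lt_coe_iff.mp hc
  have hW : {f : M → ℝ | f z < h' z - c} ∈ 𝓝[horoCpt d b] h :=
    mem_nhdsWithin_of_mem_nhds
      ((isOpen_lt (continuous_apply z) continuous_const).mem_nhds (by simp; linarith))
  refine le_iSup₂_of_le _ hW (le_iInf₂ fun x hx => EReal.coe_le_coe_iff.mpr ?_)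
  have hx' : d z x - d b x < h' z - c := hx
  linarith [hlip z x]

lemma detourCost_maxFn (hd : Disjoint I J) (hI : I.Nonempty) (hJ : J.Nonempty)
    {α : Fin n → ℝ} (β : Fin n → ℝ) (hαI : I.inf' hI α = 0) (hαJ : J.inf' hJ α = 0) :
    detourCost (dVar n) (zeroT n) (maxFn hI hJ α) (maxFn hI hJ β) =
      (((I.sup' hI fun i => α i - β i) + (J.sup' hJ fun j => α j - β j) : ℝ) : EReal) := by
  refine le_antisymm (iSup₂_le fun W hW => ?_) ?_
  · obtain ⟨t, htW, ht⟩ := (((tendsto_intFn_ray hd hI hJ hαI hαJ).eventually_mem hW).and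
      (eventually_dVar_ray hd hI hJ α (zeroT n))).exists
    refine iInf₂_le_of_le _ htW (EReal.coe_le_coe_iff.mpr ?_)
    rw [ht, maxFn_ray hd, maxFn_zeroT hI hJ hαI hαJ]
    linarith
  · convert sub_le_detourCost (dVar n) (zeroT n) (maxFn hI hJ α) (maxFn hI hJ β)
      (maxFn_le_add_dVar hI hJ β) (centered (rayVec I J α 0)) using 2
    simp [maxFn_ray hd]

end

theorem stmt11 (n : ℕ) (hn : 2 ≤ n) (I J : Finset (Fin n)) (hd : Disjoint I J)
    (hI : I.Nonempty) (hJ : J.Nonempty) (α β : Fin n → ℝ)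
    (hα : ∀ k ∈ I ∪ J, 0 ≤ α k) (hαI : I.inf' hI α = 0) (hαJ : J.inf' hJ α = 0)
    (hβ : ∀ k ∈ I ∪ J, 0 ≤ β k) (hβI : I.inf' hI β = 0) (hβJ : J.inf' hJ β = 0)
    (g g' : Tsp n → ℝ)
    (hg : ∀ v, g v = I.sup' hI (fun i => -v.1 i - α i) + J.sup' hJ (fun j => v.1 j - α j))
    (hg' : ∀ v, g' v = I.sup' hI (fun i => -v.1 i - β i) + J.sup' hJ (fun j => v.1 j - β j)) :
    detourDist (dVar n) (zeroT n) g g' < ⊤ ∧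
    detourDist (dVar n) (zeroT n) g g' =
      ((((I.sup' hI fun i => α i - β i) + (I.sup' hI fun i => β i - α i)) +
        ((J.sup' hJ fun j => α j - β j) + (J.sup' hJ fun j => β j - α j)) : ℝ) : EReal) := by
  obtain rfl : g = maxFn hI hJ α := funext hg
  obtain rfl : g' = maxFn hI hJ β := funext hg'
  have key : detourDist (dVar n) (zeroT n) (maxFn hI hJ α) (maxFn hI hJ β) =
      ((((I.sup' hI fun i => α i - β i) + (I.sup' hI fun i => β i - α i)) +
        ((J.sup' hJ fun j => α j - β j) + (J.sup' hJ fun j => β j - α j)) : ℝ) : EReal) := by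
    rw [detourDist, detourCost_maxFn hd hI hJ β hαI hαJ, detourCost_maxFn hd hI hJ α hβI hβJ,
      ← EReal.coe_add, add_add_add_comm]
  exact ⟨key ▸ EReal.coe_lt_top _, key⟩
end

section
/- Let g and g′ be horofunctions of (T, |·|) given by g(v) = max_{i∈I}(−v_i − α_i) + max_{j∈J}(v_j − α_j) and g′(v) = max_{i∈I′}(−v_i − β_i) + max_{j∈J′}(v_j − β_j), where I, J ⊆ {1,…,n} are disjoint and nonempty, I′, J′ ⊆ {1,…,n} are disjoint and nonempty, α ≥ 0 with min_{i∈I} α_i = 0 = min_{j∈J} α_j, and β ≥ 0 with min_{i∈I′} β_i = 0 = min_{j∈J′} β_j. Then g and g′ are in the same part (i.e. δ(g,g′) < ∞) if and only if I = I′ and J = J′. -/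
open Filter Topology

/-- The function `v ↦ max_{i ∈ I} (-v_i - α_i) + max_{j ∈ J} (v_j - α_j)` on `T`. -/
noncomputable def horoFn {n : ℕ} (I J : Finset (Fin n)) (hI : I.Nonempty) (hJ : J.Nonempty)
    (α : Fin n → ℝ) (v : Tsp n) : ℝ :=
  I.sup' hI (fun i => -v.1 i - α i) + J.sup' hJ (fun j => v.1 j - α j)

/-- The translate of `w ∈ ℝⁿ` along `(1, …, 1)` that lies in `T`. -/
noncomputable def centre {n : ℕ} (hn : n ≠ 0) (w : Fin n → ℝ) : Tsp n :=
  ⟨fun i => w i - (∑ k, w k) / n, by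
    have : (n : ℝ) ≠ 0 := by exact_mod_cast hn
    simp only [Finset.sum_sub_distrib, Finset.sum_const, Finset.card_univ, Fintype.card_fin,
      nsmul_eq_mul]
    field_simp
    ring⟩

/-- A family of points of `T` that converges to `horoFn I J _ _ α` as `t → ∞`. -/
noncomputable def rayPt {n : ℕ} (hn : n ≠ 0) (I J : Finset (Fin n)) (α : Fin n → ℝ) (t : ℝ) :
    Tsp n :=
  centre hn fun i => if i ∈ I then t - α i else if i ∈ J then -t + α i else 0

section dVar

variable {n : ℕ}

lemma sub_le_dVar (v w : Tsp n) (i j : Fin n) :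
    (v.1 i - w.1 i) - (v.1 j - w.1 j) ≤ dVar n v w :=
  sub_le_sub (le_ciSup (f := fun i => v.1 i - w.1 i) (Set.finite_range _).bddAbove i)
    (ciInf_le (f := fun i => v.1 i - w.1 i) (Set.finite_range _).bddBelow j)

lemma dVar_eq_sub {v w : Tsp n} {a b : ℝ} {i j : Fin n} (hi : v.1 i - w.1 i = a)
    (hj : v.1 j - w.1 j = b) (ha : ∀ k, v.1 k - w.1 k ≤ a) (hb : ∀ k, b ≤ v.1 k - w.1 k) :
    dVar n v w = a - b := by
  have : Nonempty (Fin n) := ⟨i⟩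
  refine le_antisymm (sub_le_sub (ciSup_le ha) (le_ciInf hb)) ?_
  rw [← hi, ← hj]
  exact sub_le_dVar v w i j

end dVar

section horoFn

variable {n : ℕ} {I J : Finset (Fin n)} {hI : I.Nonempty} {hJ : J.Nonempty} {α : Fin n → ℝ}

lemma le_horoFn (v : Tsp n) {i j : Fin n} (hi : i ∈ I) (hj : j ∈ J) :
    (-v.1 i - α i) + (v.1 j - α j) ≤ horoFn I J hI hJ α v :=
  add_le_add (Finset.le_sup' (fun i => -v.1 i - α i) hi)
    (Finset.le_sup' (fun j => v.1 j - α j) hj)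

lemma horoFn_le {v : Tsp n} {c : ℝ}
    (h : ∀ i ∈ I, ∀ j ∈ J, (-v.1 i - α i) + (v.1 j - α j) ≤ c) :
    horoFn I J hI hJ α v ≤ c := by
  obtain ⟨i, hi, hi'⟩ := I.exists_mem_eq_sup' hI (fun i => -v.1 i - α i)
  obtain ⟨j, hj, hj'⟩ := J.exists_mem_eq_sup' hJ (fun j => v.1 j - α j)
  rw [horoFn, hi', hj']
  exact h i hi j hj

lemma horoFn_le_add_dVar (v w : Tsp n) :
    horoFn I J hI hJ α v ≤ horoFn I J hI hJ α w + dVar n v w := by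
  refine horoFn_le fun i hi j hj => ?_
  have h₁ := le_horoFn (hI := hI) (hJ := hJ) (α := α) w hi hj
  have h₂ := sub_le_dVar v w j i
  linarith

lemma exists_horoFn_le_add (α β : Fin n → ℝ) :
    ∃ C, ∀ v, horoFn I J hI hJ β v ≤ horoFn I J hI hJ α v + C := by
  have hK (k : Fin n) : α k - β k ≤ ⨆ k, (α k - β k) :=
    le_ciSup (f := fun k => α k - β k) (Set.finite_range _).bddAbove k
  refine ⟨2 * ⨆ k, (α k - β k), fun v => horoFn_le fun i hi j hj => ?_⟩
  have h₁ := le_horoFn (hI := hI) (hJ := hJ) (α := α) v hi hj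
  linarith [hK i, hK j]

lemma horoFn_zeroT (hαI : I.inf' hI α = 0) (hαJ : J.inf' hJ α = 0) :
    horoFn I J hI hJ α (zeroT n) = 0 := by
  obtain ⟨i, hi, hi'⟩ := I.exists_mem_eq_inf' hI α
  obtain ⟨j, hj, hj'⟩ := J.exists_mem_eq_inf' hJ α
  apply le_antisymm
  · refine horoFn_le fun k hk l hl => ?_
    have h₁ := Finset.inf'_le α hk
    have h₂ := Finset.inf'_le α hl
    simp only [zeroT, Pi.zero_apply]
    linarith
  · refine le_trans ?_ (le_horoFn _ hi hj)
    simp only [zeroT, Pi.zero_apply]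
    linarith

lemma dVar_zeroT_add_horoFn_nonneg (hαI : I.inf' hI α = 0) (hαJ : J.inf' hJ α = 0)
    (v : Tsp n) : 0 ≤ dVar n (zeroT n) v + horoFn I J hI hJ α v := by
  have := horoFn_le_add_dVar (hI := hI) (hJ := hJ) (α := α) (zeroT n) v
  rw [horoFn_zeroT hαI hαJ] at this
  linarith

lemma horoFn_rayPt (hn : n ≠ 0) (hd : Disjoint I J) (t : ℝ) :
    horoFn I J hI hJ α (rayPt hn I J α t) = -2 * t := by
  have key : ∀ i ∈ I, ∀ j ∈ J, (-(rayPt hn I J α t).1 i - α i) +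
      ((rayPt hn I J α t).1 j - α j) = -2 * t := by
    intro i hi j hj
    have hj' := Finset.disjoint_right.mp hd hj
    simp only [rayPt, centre, hi, hj, hj', if_true, if_false]
    ring
  obtain ⟨i, hi⟩ := id hI
  obtain ⟨j, hj⟩ := id hJ
  exact le_antisymm (horoFn_le fun i hi j hj => (key i hi j hj).le)
    ((key i hi j hj).symm.le.trans (le_horoFn _ hi hj))

lemma eventually_dVar_rayPt (hn : n ≠ 0) (hd : Disjoint I J) (z : Tsp n) :
    ∀ᶠ t in atTop, dVar n z (rayPt hn I J α t) = horoFn I J hI hJ α z + 2 * t := by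
  obtain ⟨i, hi, hi'⟩ := I.exists_mem_eq_sup' hI (fun i => -z.1 i - α i)
  obtain ⟨j, hj, hj'⟩ := J.exists_mem_eq_sup' hJ (fun j => z.1 j - α j)
  have hIle (k) (hk : k ∈ I) := Finset.le_sup' (fun i => -z.1 i - α i) hk
  have hJle (k) (hk : k ∈ J) := Finset.le_sup' (fun j => z.1 j - α j) hk
  have hjI := Finset.disjoint_right.mp hd hj
  simp only [horoFn]
  set SI := I.sup' hI (fun i => -z.1 i - α i)
  set SJ := J.sup' hJ (fun j => z.1 j - α j)
  have hev : ∀ᶠ t in atTop, ∀ k, |z.1 k| + |α k| + |SI| + |SJ| ≤ t :=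
    eventually_all.mpr fun k => eventually_ge_atTop _
  filter_upwards [hev] with t ht
  set s := (∑ k, if k ∈ I then t - α k else if k ∈ J then -t + α k else 0) / (n : ℝ)
  have hray (k) : (rayPt hn I J α t).1 k =
      (if k ∈ I then t - α k else if k ∈ J then -t + α k else 0) - s := rfl
  have habs (k) : z.1 k + α k - SJ ≤ t ∧ z.1 k - SJ ≤ t ∧ -z.1 k + α k - SI ≤ t ∧
      -z.1 k - SI ≤ t ∧ 0 ≤ t := by
    have := ht k
    have h₁ := neg_abs_le SI
    have h₂ := neg_abs_le SJ
    have h₃ := abs_le.mp (le_refl |z.1 k|)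
    have h₄ := le_abs_self (α k)
    have h₅ := abs_nonneg (α k)
    have h₆ := abs_nonneg SI
    have h₇ := abs_nonneg SJ
    have h₈ := abs_nonneg (z.1 k)
    refine ⟨?_, ?_, ?_, ?_, ?_⟩ <;> linarith
  rw [dVar_eq_sub (a := SJ + t + s) (b := -SI - t + s) (i := j) (j := i)]
  · ring
  · rw [hray, if_neg hjI, if_pos hj]
    linarith
  · rw [hray, if_pos hi]
    linarith
  · intro k
    obtain ⟨h₁, h₂, -, -, h₅⟩ := habs k
    rw [hray]
    split_ifs with hkI hkJ
    · linarith
    · linarith [hJle k hkJ]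
    · linarith
  · intro k
    obtain ⟨-, -, h₃, h₄, h₅⟩ := habs k
    rw [hray]
    split_ifs with hkI hkJ
    · linarith [hIle k hkI]
    · linarith
    · linarith

lemma tendsto_intFn_rayPt (hn : n ≠ 0) (hd : Disjoint I J) (hαI : I.inf' hI α = 0)
    (hαJ : J.inf' hJ α = 0) :
    Tendsto (fun t => intFn (dVar n) (zeroT n) (rayPt hn I J α t)) atTop
      (𝓝 (horoFn I J hI hJ α)) := by
  refine tendsto_pi_nhds.mpr fun z => tendsto_const_nhds.congr' ?_
  filter_upwards [eventually_dVar_rayPt (hI := hI) (hJ := hJ) (α := α) hn hd z,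
    eventually_dVar_rayPt (hI := hI) (hJ := hJ) (α := α) hn hd (zeroT n)] with t hz h0
  rw [intFn, hz, h0, horoFn_zeroT hαI hαJ]
  ring

end horoFn

section detourCost

variable {M : Type*} {d : M → M → ℝ} {b : M} {h h' : M → ℝ}

lemma detourCost_nonneg (h : M → ℝ) (hh' : ∀ x, 0 ≤ d b x + h' x) :
    0 ≤ detourCost d b h h' :=
  le_iSup₂_of_le Set.univ univ_mem (le_iInf₂ fun x _ => EReal.coe_nonneg.mpr (hh' x))

lemma detourCost_le_of_tendsto {ι : Type*} {l : Filter ι} [l.NeBot] {y : ι → M} {C : ℝ}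
    (hy : Tendsto (fun i => intFn d b (y i)) l (𝓝 h)) (hC : ∀ᶠ i in l, d b (y i) + h' (y i) ≤ C) :
    detourCost d b h h' ≤ C := by
  refine iSup₂_le fun W hW => ?_
  have hy' : Tendsto (fun i => intFn d b (y i)) l (𝓝[horoCpt d b] h) :=
    tendsto_nhdsWithin_iff.mpr
      ⟨hy, Eventually.of_forall fun i => subset_closure (Set.mem_range_self _)⟩
  obtain ⟨i, hiW, hiC⟩ := ((hy'.eventually_mem hW).and hC).exists
  exact iInf₂_le_of_le (y i) hiW (EReal.coe_le_coe_iff.mpr hiC)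

lemma exists_le_add_of_detourCost_lt_top (hlip : ∀ z x, h' z ≤ h' x + d z x)
    (hlt : detourCost d b h h' < ⊤) : ∃ C, ∀ z, h' z ≤ h z + C := by
  obtain ⟨C, hC, -⟩ := EReal.lt_iff_exists_real_btwn.mp hlt
  refine ⟨C + 1, fun z => ?_⟩
  have hW : {f : M → ℝ | f z < h z + 1} ∈ 𝓝[horoCpt d b] h :=
    mem_nhdsWithin_of_mem_nhds
      ((continuous_apply z).continuousAt.eventually_lt continuousAt_const (lt_add_one (h z)))
  have hinf := (le_iSup₂ (f := fun W (_ : W ∈ 𝓝[horoCpt d b] h) =>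
    ⨅ x ∈ {x : M | intFn d b x ∈ W}, ((d b x + h' x : ℝ) : EReal)) _ hW).trans_lt hC
  simp only [iInf_lt_iff] at hinf
  obtain ⟨x, hx, hxC⟩ := hinf
  have hx' : d z x - d b x < h z + 1 := hx
  have hxC' := EReal.coe_lt_coe_iff.mp hxC
  linarith [hlip z x]

end detourCost

section parts

variable {n : ℕ} {I J I' J' : Finset (Fin n)} {hI : I.Nonempty} {hJ : J.Nonempty}
  {hI' : I'.Nonempty} {hJ' : J'.Nonempty} {α β : Fin n → ℝ}

lemma subset_of_horoFn_le_add (hd' : Disjoint I' J') (hα : ∀ k ∈ I ∪ J, 0 ≤ α k) {C : ℝ}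
    (hC : ∀ v, horoFn I' J' hI' hJ' β v ≤ horoFn I J hI hJ α v + C) : I' ⊆ I ∧ J' ⊆ J := by
  have hαI (k) (hk : k ∈ I) : 0 ≤ α k := hα k (Finset.mem_union_left _ hk)
  have hαJ (k) (hk : k ∈ J) : 0 ≤ α k := hα k (Finset.mem_union_right _ hk)
  obtain ⟨i, hi⟩ := id hI'
  obtain ⟨j, hj⟩ := id hJ'
  have hn : n ≠ 0 := (Fin.pos i).ne'
  constructor
  · intro k hk
    by_contra hkI
    have hjk : j ≠ k := fun h => Finset.disjoint_left.mp hd' hk (h ▸ hj)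
    set t := |C + β k + β j| + 1 with ht
    have hCt := le_abs_self (C + β k + β j)
    set v := centre hn (Pi.single k (-t))
    have hle : horoFn I J hI hJ α v ≤ 0 := by
      refine horoFn_le fun i hi l hl => ?_
      have hik : i ≠ k := fun h => hkI (h ▸ hi)
      simp only [v, centre, Pi.single_apply, hik, if_false]
      have := abs_nonneg (C + β k + β j)
      split_ifs <;> linarith [hαI i hi, hαJ l hl]
    have hge := (le_horoFn v hk hj).trans ((hC v).trans (add_le_add_left hle C))
    simp only [v, centre, Pi.single_apply, hjk, if_false, if_true] at hge
    linarith
  · intro k hk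
    by_contra hkJ
    have hik : i ≠ k := fun h => Finset.disjoint_left.mp hd' hi (h ▸ hk)
    set t := |C + β k + β i| + 1 with ht
    have hCt := le_abs_self (C + β k + β i)
    set v := centre hn (Pi.single k t)
    have hle : horoFn I J hI hJ α v ≤ 0 := by
      refine horoFn_le fun m hm l hl => ?_
      have hlk : l ≠ k := fun h => hkJ (h ▸ hl)
      simp only [v, centre, Pi.single_apply, hlk, if_false]
      have := abs_nonneg (C + β k + β i)
      split_ifs <;> linarith [hαI m hm, hαJ l hl]
    have hge := (le_horoFn v hi hk).trans ((hC v).trans (add_le_add_left hle C))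
    simp only [v, centre, Pi.single_apply, hik, if_false, if_true] at hge
    linarith

lemma subset_of_detourCost_lt_top (hd' : Disjoint I' J') (hα : ∀ k ∈ I ∪ J, 0 ≤ α k)
    (h : detourCost (dVar n) (zeroT n) (horoFn I J hI hJ α) (horoFn I' J' hI' hJ' β) < ⊤) :
    I' ⊆ I ∧ J' ⊆ J := by
  obtain ⟨C, hC⟩ := exists_le_add_of_detourCost_lt_top horoFn_le_add_dVar h
  exact subset_of_horoFn_le_add hd' hα hC

lemma detourCost_horoFn_lt_top (hd : Disjoint I J) (hαI : I.inf' hI α = 0)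
    (hαJ : J.inf' hJ α = 0) :
    detourCost (dVar n) (zeroT n) (horoFn I J hI hJ α) (horoFn I J hI hJ β) < ⊤ := by
  have hn : n ≠ 0 := (Fin.pos hI.choose).ne'
  obtain ⟨C, hC⟩ := exists_horoFn_le_add (hI := hI) (hJ := hJ) α β
  refine (detourCost_le_of_tendsto (C := C) (tendsto_intFn_rayPt hn hd hαI hαJ) ?_).trans_lt
    (EReal.coe_lt_top C)
  filter_upwards [eventually_dVar_rayPt (hI := hI) (hJ := hJ) (α := α) hn hd (zeroT n)]
    with t ht
  have := hC (rayPt hn I J α t)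
  rw [horoFn_rayPt hn hd] at this
  rw [ht, horoFn_zeroT hαI hαJ]
  linarith

end parts

theorem stmt12 (n : ℕ) (hn : 2 ≤ n) (I J I' J' : Finset (Fin n))
    (hd : Disjoint I J) (hd' : Disjoint I' J')
    (hI : I.Nonempty) (hJ : J.Nonempty) (hI' : I'.Nonempty) (hJ' : J'.Nonempty)
    (α β : Fin n → ℝ)
    (hα : ∀ k ∈ I ∪ J, 0 ≤ α k) (hαI : I.inf' hI α = 0) (hαJ : J.inf' hJ α = 0)
    (hβ : ∀ k ∈ I' ∪ J', 0 ≤ β k) (hβI : I'.inf' hI' β = 0) (hβJ : J'.inf' hJ' β = 0)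
    (g g' : Tsp n → ℝ)
    (hg : ∀ v, g v = I.sup' hI (fun i => -v.1 i - α i) + J.sup' hJ (fun j => v.1 j - α j))
    (hg' : ∀ v, g' v = I'.sup' hI' (fun i => -v.1 i - β i) + J'.sup' hJ' (fun j => v.1 j - β j)) :
    detourDist (dVar n) (zeroT n) g g' < ⊤ ↔ I = I' ∧ J = J' := by
  obtain rfl : g = horoFn I J hI hJ α := funext hg
  obtain rfl : g' = horoFn I' J' hI' hJ' β := funext hg'
  constructor
  · intro h
    have h₁ := detourCost_nonneg (horoFn I J hI hJ α)
      (dVar_zeroT_add_horoFn_nonneg (hI := hI') (hJ := hJ') hβI hβJ)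
    have h₂ := detourCost_nonneg (horoFn I' J' hI' hJ' β)
      (dVar_zeroT_add_horoFn_nonneg (hI := hI) (hJ := hJ) hαI hαJ)
    obtain ⟨hI'I, hJ'J⟩ :=
      subset_of_detourCost_lt_top hd' hα ((le_add_of_nonneg_right h₂).trans_lt h)
    obtain ⟨hII', hJJ'⟩ :=
      subset_of_detourCost_lt_top hd hβ ((le_add_of_nonneg_left h₁).trans_lt h)
    exact ⟨hII'.antisymm hI'I, hJJ'.antisymm hJ'J⟩
  · rintro ⟨rfl, rfl⟩
    exact EReal.add_lt_top (detourCost_horoFn_lt_top hd hαI hαJ).ne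
      (detourCost_horoFn_lt_top hd hβI hβJ).ne
end
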